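/- arXiv:2309.14301 — 2 statements merged into one kernel-verified Lean document; each statement's English description precedes it below -/
import Mathlib

section
/- Let n ≥ 1, i ∈ {1,…,n}, s ∈ (0,1), p ∈ (1,∞) and R > 0. Let u : ℝ^n → ℝ be a measurable function with u = 0 outside the cube Q_R = [−R,R]^n. Then ∫_{ℝ^n} ∫_ℝ |u(x+h e_i) − u(x)|^p / |h|^{1+sp} dh dx ≥ C ∫_{ℝ^n} |u(x)|^p dx, where C = ∫_{|h| ≥ 2R} |h|^{−1−sp} dh = 2 / (s p (2R)^{sp}) > 0 depends only on R, s and p. -/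
open MeasureTheory Filter Topology
open scoped ENNReal

noncomputable section

/-- `mixedAuxE n p u j` : the `j`-th iterated integral `I_j(u)` (ENNReal-valued),
integrating out the first `j` coordinates with exponents `p 0, …, p (j-1)`. -/
def mixedAuxE (n : ℕ) (p : ℕ → ℝ) (u : (Fin n → ℝ) → ℝ) : ℕ → (Fin n → ℝ) → ℝ≥0∞
  | 0, x => ENNReal.ofReal |u x|
  | (j+1), x =>
      (∫⁻ t : ℝ,
          (if h : j < n then mixedAuxE n p u j (Function.update x ⟨j, h⟩ t)
           else mixedAuxE n p u j x) ^ p j) ^ (p j)⁻¹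

/-- The mixed Lebesgue (quasi-)norm `‖u‖_𝐩` (ENNReal-valued). -/
def mixedNormE (n : ℕ) (p : ℕ → ℝ) (u : (Fin n → ℝ) → ℝ) : ℝ≥0∞ :=
  mixedAuxE n p u n 0

/-- The mixed Lebesgue norm `‖u‖_𝐩` (real-valued). -/
def mixedNorm (n : ℕ) (p : ℕ → ℝ) (u : (Fin n → ℝ) → ℝ) : ℝ :=
  (mixedNormE n p u).toReal

/-- Membership in the mixed Lebesgue space `L^𝐩(ℝ^n)`. -/
def MemMixedLp (n : ℕ) (p : ℕ → ℝ) (u : (Fin n → ℝ) → ℝ) : Prop :=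
  AEMeasurable u ∧ mixedNormE n p u < ⊤

/-- Membership in `L^𝐩(Ω)`: members of `L^𝐩(ℝ^n)` vanishing a.e. outside `Ω`. -/
def MemMixedLpOn (n : ℕ) (p : ℕ → ℝ) (Ω : Set (Fin n → ℝ)) (u : (Fin n → ℝ) → ℝ) : Prop :=
  MemMixedLp n p u ∧ ∀ᵐ x, x ∉ Ω → u x = 0

/-- `L^q(ℝ^n)` norm (ENNReal-valued). -/
def LpNormE (n : ℕ) (q : ℝ) (f : (Fin n → ℝ) → ℝ) : ℝ≥0∞ :=
  (∫⁻ x : Fin n → ℝ, ENNReal.ofReal |f x| ^ q) ^ q⁻¹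

/-- `L^q(ℝ^n)` norm (real-valued). -/
def LpNorm (n : ℕ) (q : ℝ) (f : (Fin n → ℝ) → ℝ) : ℝ := (LpNormE n q f).toReal

/-- Membership in `L^q(ℝ^n)`. -/
def MemLpR (n : ℕ) (q : ℝ) (f : (Fin n → ℝ) → ℝ) : Prop :=
  AEMeasurable f ∧ LpNormE n q f < ⊤

/-- `i`-th partial derivative. -/
def pderiv' (n : ℕ) (i : Fin n) (u : (Fin n → ℝ) → ℝ) : (Fin n → ℝ) → ℝ :=
  fun x => fderiv ℝ u x (Pi.single i 1)

/-- The anisotropic gradient norm `‖∇u‖_𝐩 = ∑ᵢ ‖u_{xᵢ}‖_{pᵢ}`. -/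
def gradNorm (n : ℕ) (p : ℕ → ℝ) (u : (Fin n → ℝ) → ℝ) : ℝ :=
  ∑ i : Fin n, LpNorm n (p (i : ℕ)) (pderiv' n i u)

/-- The anisotropic Sobolev norm `‖u‖_{1,𝐩} = ‖u‖_𝐩 + ‖∇u‖_𝐩`. -/
def sobNorm (n : ℕ) (p : ℕ → ℝ) (u : (Fin n → ℝ) → ℝ) : ℝ :=
  mixedNorm n p u + gradNorm n p u

/-- `W^{1,𝐩}_0(Ω)`: closure of `C_c^∞(Ω)` in the anisotropic Sobolev norm. -/
def MemW1p0 (n : ℕ) (p : ℕ → ℝ) (Ω : Set (Fin n → ℝ)) (u : (Fin n → ℝ) → ℝ) : Prop :=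
  ∃ φ : ℕ → (Fin n → ℝ) → ℝ,
    (∀ k, ContDiff ℝ (⊤ : ℕ∞) (φ k) ∧ HasCompactSupport (φ k) ∧ tsupport (φ k) ⊆ Ω) ∧
    Tendsto (fun k => sobNorm n p (fun x => u x - φ k x)) atTop (𝓝 0)

/-- The `i`-th canonical basis vector of `ℝ^n`. -/
def ePt (n : ℕ) (i : Fin n) : Fin n → ℝ := Pi.single i 1

/-- Directional fractional seminorm `[u]_{s,q,i}` (ENNReal-valued). -/
def fracSemiE (n : ℕ) (s q : ℝ) (i : Fin n) (u : (Fin n → ℝ) → ℝ) : ℝ≥0∞ :=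
  (∫⁻ x : Fin n → ℝ, ∫⁻ h : ℝ,
      ENNReal.ofReal (|u (x + h • ePt n i) - u x| ^ q / |h| ^ (1 + s * q))) ^ q⁻¹

/-- Directional fractional seminorm `[u]_{s,q,i}` (real-valued). -/
def fracSemi (n : ℕ) (s q : ℝ) (i : Fin n) (u : (Fin n → ℝ) → ℝ) : ℝ :=
  (fracSemiE n s q i u).toReal

/-- The anisotropic fractional seminorm `[u]_{𝐬,𝐩} = ∑ᵢ [u]_{sᵢ,pᵢ,i}`. -/
def fracNorm (n : ℕ) (s p : ℕ → ℝ) (u : (Fin n → ℝ) → ℝ) : ℝ :=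
  ∑ i : Fin n, fracSemi n (s (i : ℕ)) (p (i : ℕ)) i u

/-- The fractional anisotropic Sobolev norm `‖u‖_𝐩 + [u]_{𝐬,𝐩}`. -/
def fracSobNorm (n : ℕ) (s p : ℕ → ℝ) (u : (Fin n → ℝ) → ℝ) : ℝ :=
  mixedNorm n p u + fracNorm n s p u

/-- `W^{𝐬,𝐩}_0(Ω)`: closure of `C_c^∞(Ω)` in the fractional anisotropic Sobolev norm. -/
def MemWsp0 (n : ℕ) (s p : ℕ → ℝ) (Ω : Set (Fin n → ℝ)) (u : (Fin n → ℝ) → ℝ) : Prop :=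
  ∃ φ : ℕ → (Fin n → ℝ) → ℝ,
    (∀ k, ContDiff ℝ (⊤ : ℕ∞) (φ k) ∧ HasCompactSupport (φ k) ∧ tsupport (φ k) ⊆ Ω) ∧
    Tendsto (fun k => fracSobNorm n s p (fun x => u x - φ k x)) atTop (𝓝 0)

/-- The nonlinear functional `𝓕_𝐩(u) = (∏ᵢ Iᵢ(u)^{p_{i+1}-p_i}) |u|^{p_1-2} u`,
with the convention `p_{n+1} := 1` (0-indexed: `p n := 1`). -/
def Fp (n : ℕ) (p : ℕ → ℝ) (u : (Fin n → ℝ) → ℝ) : (Fin n → ℝ) → ℝ :=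
  fun x =>
    (∏ i : Fin n,
        ((mixedAuxE n p u ((i : ℕ) + 1) x).toReal)
          ^ ((if (i : ℕ) + 1 < n then p ((i : ℕ) + 1) else 1) - p (i : ℕ)))
      * |u x| ^ (p 0 - 2) * u x

/-- The pairing `⟨𝓛_𝐩 u, v⟩ = ⟨H'(u), v⟩`. -/
def pairingLp (n : ℕ) (p : ℕ → ℝ) (u v : (Fin n → ℝ) → ℝ) : ℝ :=
  ∑ i : Fin n, ∫ x : Fin n → ℝ,
    |pderiv' n i u x / LpNorm n (p (i : ℕ)) (pderiv' n i u)| ^ (p (i : ℕ) - 2)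
      * (pderiv' n i u x / LpNorm n (p (i : ℕ)) (pderiv' n i u)) * pderiv' n i v x

/-- The fractional difference quotient `D^{s,i}_h u (x)`. -/
def Dquot (n : ℕ) (s : ℝ) (i : Fin n) (u : (Fin n → ℝ) → ℝ) (h : ℝ) (x : Fin n → ℝ) : ℝ :=
  (u (x + h • ePt n i) - u x) / |h| ^ s

/-- The pairing `⟨𝓛_{𝐬,𝐩} u, v⟩ = ⟨H_𝐬'(u), v⟩`. -/
def pairingLsp (n : ℕ) (s p : ℕ → ℝ) (u v : (Fin n → ℝ) → ℝ) : ℝ :=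
  ∑ i : Fin n, ∫ x : Fin n → ℝ, ∫ h : ℝ,
    |Dquot n (s (i : ℕ)) i u h x / fracSemi n (s (i : ℕ)) (p (i : ℕ)) i u| ^ (p (i : ℕ) - 2)
      * (Dquot n (s (i : ℕ)) i u h x / fracSemi n (s (i : ℕ)) (p (i : ℕ)) i u)
      * Dquot n (s (i : ℕ)) i v h x / |h|

/-- Harmonic mean of `(q 0, …, q (n-1))`. -/
def harmMean (n : ℕ) (q : ℕ → ℝ) : ℝ := ((n : ℝ)⁻¹ * ∑ i : Fin n, (q (i : ℕ))⁻¹)⁻¹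

/-- Critical Sobolev exponent `𝐩* = n p̄ / (n - p̄)`. -/
def pstar (n : ℕ) (p : ℕ → ℝ) : ℝ :=
  (n : ℝ) * harmMean n p / ((n : ℝ) - harmMean n p)

/-- Fractional critical exponent `𝐩*_𝐬`. -/
def pstarS (n : ℕ) (s p : ℕ → ℝ) : ℝ :=
  (n : ℝ) * (harmMean n (fun i => s i * p i) / harmMean n s)
    / ((n : ℝ) - harmMean n (fun i => s i * p i))

/-- The eigenvalue set `Σ^𝐩` of `-𝓛_𝐩 u = λ 𝓕_𝐩(u)` in `Ω`. -/
def EigenSetP (n : ℕ) (p : ℕ → ℝ) (Ω : Set (Fin n → ℝ)) : Set ℝ :=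
  {lam | ∃ u : (Fin n → ℝ) → ℝ, MemW1p0 n p Ω u ∧ mixedNormE n p u ≠ 0 ∧
    ∀ v, MemW1p0 n p Ω v → pairingLp n p u v = lam * ∫ x : Fin n → ℝ, Fp n p u x * v x}

/-- The eigenvalue set `Σ^{𝐬,𝐩}` of `-𝓛_{𝐬,𝐩} u = λ 𝓕_𝐩(u)` in `Ω`. -/
def EigenSetSP (n : ℕ) (s p : ℕ → ℝ) (Ω : Set (Fin n → ℝ)) : Set ℝ :=
  {lam | ∃ u : (Fin n → ℝ) → ℝ, MemWsp0 n s p Ω u ∧ mixedNormE n p u ≠ 0 ∧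
    ∀ v, MemWsp0 n s p Ω v → pairingLsp n s p u v = lam * ∫ x : Fin n → ℝ, Fp n p u x * v x}

/-- Sequential compactness of `K` with respect to the (norm-induced) distance `N (u - v)`. -/
def SeqCompactIn (n : ℕ) (N : ((Fin n → ℝ) → ℝ) → ℝ) (K : Set ((Fin n → ℝ) → ℝ)) : Prop :=
  ∀ U : ℕ → (Fin n → ℝ) → ℝ, (∀ k, U k ∈ K) →
    ∃ (φ : ℕ → ℕ) (u : (Fin n → ℝ) → ℝ), StrictMono φ ∧ u ∈ K ∧
      Tendsto (fun j => N (fun x => U (φ j) x - u x)) atTop (𝓝 0)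

/-- The Krasnoselskii genus of `K` is at least `k` (w.r.t. the norm `N`): there is no odd
map `K → ℝ^m \ {0}`, continuous on `K` for the `N`-distance, with `m < k`. -/
def GenusGe (n : ℕ) (N : ((Fin n → ℝ) → ℝ) → ℝ) (K : Set ((Fin n → ℝ) → ℝ)) (k : ℕ) : Prop :=
  ∀ m : ℕ,
    (∃ f : ((Fin n → ℝ) → ℝ) → (Fin m → ℝ),
      (∀ u ∈ K, f (-u) = -(f u)) ∧ (∀ u ∈ K, f u ≠ 0) ∧
      (∀ u ∈ K, ∀ ε : ℝ, 0 < ε → ∃ δ : ℝ, 0 < δ ∧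
        ∀ w ∈ K, N (fun x => w x - u x) ≤ δ → ‖f w - f u‖ ≤ ε)) →
    k ≤ m

/-- The tail integral of `h ↦ |h| ^ (-(1 + r))` over a right half-line. -/
theorem setLIntegral_Ioi_abs_rpow {r a : ℝ} (hr : 0 < r) (ha : 0 < a) :
    ∫⁻ h in Set.Ioi a, ENNReal.ofReal (|h| ^ (-(1 + r))) = ENNReal.ofReal (a ^ (-r) / r) := by
  have hlt : -(1 + r) < -1 := by linarith
  have habs : ∫⁻ h in Set.Ioi a, ENNReal.ofReal (|h| ^ (-(1 + r)))
      = ∫⁻ h in Set.Ioi a, ENNReal.ofReal (h ^ (-(1 + r))) :=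
    setLIntegral_congr_fun measurableSet_Ioi fun h hh => by
      simp only [abs_of_pos (ha.trans hh)]
  have hnn : 0 ≤ᵐ[volume.restrict (Set.Ioi a)] fun h : ℝ => h ^ (-(1 + r)) :=
    (ae_restrict_iff' measurableSet_Ioi).2 <| .of_forall fun h hh =>
      Real.rpow_nonneg (ha.trans hh).le _
  rw [habs, ← ofReal_integral_eq_lintegral_ofReal (integrableOn_Ioi_rpow_of_lt hlt ha) hnn,
    integral_Ioi_rpow_of_lt hlt ha, show -(1 + r) + 1 = -r by ring, neg_div_neg_eq]

/-- The tail integral of `h ↦ |h| ^ (-(1 + r))` over `{|h| > a}`. -/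
theorem setLIntegral_lt_abs_rpow {r a : ℝ} (hr : 0 < r) (ha : 0 < a) :
    ∫⁻ h in {h : ℝ | a < |h|}, ENNReal.ofReal (|h| ^ (-(1 + r)))
      = ENNReal.ofReal (2 / (r * a ^ r)) := by
  have hset : {h : ℝ | a < |h|} = Set.Ioi a ∪ Set.Iio (-a) := by
    ext h
    simp only [Set.mem_ofPred_eq, lt_abs, Set.mem_union, Set.mem_Ioi, Set.mem_Iio, lt_neg]
  have hdisj : Disjoint (Set.Ioi a) (Set.Iio (-a)) :=
    Set.disjoint_left.2 fun h (h1 : a < h) (h2 : h < -a) => by linarith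
  have hneg : ∫⁻ h in Set.Iio (-a), ENNReal.ofReal (|h| ^ (-(1 + r)))
      = ∫⁻ h in Set.Ioi a, ENNReal.ofReal (|h| ^ (-(1 + r))) := by
    have h := (Measure.measurePreserving_neg (volume : Measure ℝ)).setLIntegral_comp_preimage_emb
      (MeasurableEquiv.neg ℝ).measurableEmbedding
      (fun h => ENNReal.ofReal (|h| ^ (-(1 + r)))) (Set.Ioi a)
    simpa using h
  rw [hset, lintegral_union measurableSet_Iio hdisj, hneg, setLIntegral_Ioi_abs_rpow hr ha,
    ← ENNReal.ofReal_add (by positivity) (by positivity), Real.rpow_neg ha.le]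
  congr 1
  have := Real.rpow_pos_of_pos ha r
  field_simp
  norm_num

theorem ae_eq_setOf_lt_abs_setOf_le_abs (a : ℝ) :
    ({h : ℝ | a ≤ |h|} : Set ℝ) =ᵐ[volume] {h : ℝ | a < |h|} := by
  have hne : ∀ᵐ h : ℝ, h ∉ ({a, -a} : Set ℝ) :=
    measure_eq_zero_iff_ae_notMem.1 ((Set.toFinite _).measure_zero volume)
  filter_upwards [hne] with h hh
  refine propext ⟨fun (hle : a ≤ |h|) => lt_of_le_of_ne hle fun heq => hh ?_, fun hlt => le_of_lt hlt⟩
  rcases abs_choice h with h1 | h1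
  · left; linarith
  · right; rw [Set.mem_singleton_iff]; linarith

/-- A translation by more than the side length of a cube, along a coordinate axis, moves every point
of the cube out of it. -/
theorem add_smul_ePt_notMem_Icc {n : ℕ} {i : Fin n} {R h : ℝ} {x : Fin n → ℝ}
    (hx : x ∈ Set.Icc (fun _ => -R) (fun _ => R)) (hh : 2 * R < |h|) :
    x + h • ePt n i ∉ Set.Icc (fun _ => -R) (fun _ => R) := by
  intro hmem
  have h1 := hmem.1 i
  have h2 := hmem.2 i
  have h3 := hx.1 i
  have h4 := hx.2 i
  simp only [ePt, Pi.add_apply, Pi.smul_apply, Pi.single_eq_same, smul_eq_mul, mul_one] at h1 h2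
  exact absurd (abs_le.2 ⟨by linarith, by linarith⟩) hh.not_ge

/-- directional fractional lower bound for compactly supported functions. -/
theorem stmt2_directional_lower_bound
    (n : ℕ) (hn : 0 < n) (i : Fin n) (s q R : ℝ)
    (hs0 : 0 < s) (hs1 : s < 1) (hq1 : 1 < q) (hR : 0 < R)
    (u : (Fin n → ℝ) → ℝ) (hu : Measurable u)
    (hsupp : ∀ x : Fin n → ℝ, x ∉ Set.Icc (fun _ => -R) (fun _ => R) → u x = 0) :
    0 < 2 / (s * q * (2 * R) ^ (s * q)) ∧
    (∫⁻ h : ℝ in {h : ℝ | 2 * R ≤ |h|}, ENNReal.ofReal (|h| ^ (-(1 + s * q))))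
      = ENNReal.ofReal (2 / (s * q * (2 * R) ^ (s * q))) ∧
    ENNReal.ofReal (2 / (s * q * (2 * R) ^ (s * q))) *
        ∫⁻ x : Fin n → ℝ, ENNReal.ofReal (|u x| ^ q) ≤
      ∫⁻ x : Fin n → ℝ, ∫⁻ h : ℝ,
        ENNReal.ofReal (|u (x + h • ePt n i) - u x| ^ q / |h| ^ (1 + s * q)) := by
  have hr : 0 < s * q := by positivity
  have hR2 : 0 < 2 * R := by positivity
  refine ⟨by positivity, ?_, ?_⟩
  · rw [setLIntegral_congr (ae_eq_setOf_lt_abs_setOf_le_abs (2 * R)),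
      setLIntegral_lt_abs_rpow hr hR2]
  rw [← lintegral_const_mul' _ _ ENNReal.ofReal_ne_top]
  refine lintegral_mono fun x => ?_
  by_cases hx : x ∈ Set.Icc (fun _ => -R) (fun _ => R)
  · calc ENNReal.ofReal (2 / (s * q * (2 * R) ^ (s * q))) * ENNReal.ofReal (|u x| ^ q)
        = ∫⁻ h in {h : ℝ | 2 * R < |h|},
            ENNReal.ofReal (|h| ^ (-(1 + s * q))) * ENNReal.ofReal (|u x| ^ q) := by
          rw [lintegral_mul_const' _ _ ENNReal.ofReal_ne_top, setLIntegral_lt_abs_rpow hr hR2]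
      _ = ∫⁻ h in {h : ℝ | 2 * R < |h|},
            ENNReal.ofReal (|u (x + h • ePt n i) - u x| ^ q / |h| ^ (1 + s * q)) := by
          refine setLIntegral_congr_fun (measurableSet_lt measurable_const measurable_id.abs)
            fun h hh => ?_
          rw [hsupp _ (add_smul_ePt_notMem_Icc hx hh), zero_sub, abs_neg,
            ← ENNReal.ofReal_mul (by positivity), Real.rpow_neg (abs_nonneg h), div_eq_mul_inv,
            mul_comm]
      _ ≤ _ := setLIntegral_le_lintegral _ _
  · simp [hsupp x hx, Real.zero_rpow (zero_lt_one.trans hq1).ne']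

end
end

section
/- The functional I : L^𝐩(Ω) → ℝ, I(u) = ‖u‖_𝐩, is Gateaux differentiable away from zero, and for all u ≠ 0 and all v its derivative is given by d/dt I(u+tv)|_{t=0} = ⟨I'(u), v⟩ = ∫_{ℝ^n} (Π_{i=1}^n I_i(u)^{p_{i+1} − p_i}) |u|^{p_1−2} u v dx, with the convention p_{n+1} = 1; that is, I' = 𝓕_𝐩. -/
open MeasureTheory Filter Topology
open scoped ENNReal

noncomputable section

/-- The slice of `u` obtained by fixing the last coordinate. -/
def lastSlice {n : ℕ} (u : (Fin (n + 1) → ℝ) → ℝ) (t : ℝ) : (Fin n → ℝ) → ℝ :=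
  fun y => u (Fin.snoc y t)

theorem mixedAuxE_snoc {n : ℕ} (p : ℕ → ℝ) (u : (Fin (n + 1) → ℝ) → ℝ) (t : ℝ) {j : ℕ}
    (hj : j ≤ n) (y : Fin n → ℝ) :
    mixedAuxE (n + 1) p u j (Fin.snoc y t) = mixedAuxE n p (lastSlice u t) j y := by
  induction j generalizing y with
  | zero => rfl
  | succ j ih =>
    have h1 : j < n := hj
    have h2 : j < n + 1 := by omega
    simp only [mixedAuxE, h1, h2, dif_pos]
    congr 2 with s
    rw [← ih h1.le, Fin.snoc_update]
    rfl

theorem mixedAuxE_succ_self {n : ℕ} (p : ℕ → ℝ) (u : (Fin (n + 1) → ℝ) → ℝ)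
    (x : Fin (n + 1) → ℝ) :
    mixedAuxE (n + 1) p u (n + 1) x =
      (∫⁻ t : ℝ, mixedAuxE n p (lastSlice u t) n (Fin.init x) ^ p n) ^ (p n)⁻¹ := by
  simp only [mixedAuxE, n.lt_succ_self, dif_pos]
  congr 2 with t
  rw [← mixedAuxE_snoc p u t le_rfl]
  congr 2
  conv_lhs => rw [← Fin.snoc_init_self x]
  exact Fin.update_snoc_last (α := fun _ => ℝ) ..

theorem mixedAuxE_self (n : ℕ) (p : ℕ → ℝ) (u : (Fin n → ℝ) → ℝ) (x : Fin n → ℝ) :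
    mixedAuxE n p u n x = mixedNormE n p u := by
  induction n with
  | zero => rw [mixedNormE, Subsingleton.elim x 0]
  | succ n ih => rw [mixedNormE, mixedAuxE_succ_self, mixedAuxE_succ_self]; simp_rw [ih]

theorem mixedNormE_zero (p : ℕ → ℝ) (u : (Fin 0 → ℝ) → ℝ) :
    mixedNormE 0 p u = ENNReal.ofReal |u 0| := rfl

theorem mixedNormE_succ {n : ℕ} (p : ℕ → ℝ) (u : (Fin (n + 1) → ℝ) → ℝ) :
    mixedNormE (n + 1) p u =
      (∫⁻ t : ℝ, mixedNormE n p (lastSlice u t) ^ p n) ^ (p n)⁻¹ := by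
  rw [mixedNormE, mixedAuxE_succ_self]
  simp_rw [mixedAuxE_self]

theorem measurable_mixedAuxE {n : ℕ} (p : ℕ → ℝ) {u : (Fin n → ℝ) → ℝ} (hu : Measurable u)
    (j : ℕ) : Measurable (mixedAuxE n p u j) := by
  induction j with
  | zero => exact ENNReal.measurable_ofReal.comp hu.norm
  | succ j ih =>
    change Measurable fun x => (∫⁻ t : ℝ,
      (if h : j < n then mixedAuxE n p u j (Function.update x ⟨j, h⟩ t)
        else mixedAuxE n p u j x) ^ p j) ^ (p j)⁻¹
    refine Measurable.pow_const ?_ _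
    by_cases h : j < n
    · simp only [h, dif_pos]
      refine Measurable.lintegral_prod_right' (f := fun z : (Fin n → ℝ) × ℝ =>
        mixedAuxE n p u j (Function.update z.1 ⟨j, h⟩ z.2) ^ p j) ?_
      exact (ih.comp measurable_update').pow_const _
    · simp only [h, dif_neg, not_false_eq_true]
      exact Measurable.lintegral_prod_right' (f := fun z : (Fin n → ℝ) × ℝ =>
        mixedAuxE n p u j z.1 ^ p j) ((ih.comp measurable_fst).pow_const _)

theorem measurePreserving_snoc (n : ℕ) :
    MeasurePreserving (fun z : ℝ × (Fin n → ℝ) => (Fin.snoc z.2 z.1 : Fin (n + 1) → ℝ)) := by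
  have := (volume_preserving_piFinSuccAbove (fun _ : Fin (n + 1) => ℝ) (Fin.last n)).symm
  convert this using 1
  ext1 z
  exact (Fin.insertNth_last' ..).symm

theorem measurable_snoc {n : ℕ} :
    Measurable fun z : ℝ × (Fin n → ℝ) => (Fin.snoc z.2 z.1 : Fin (n + 1) → ℝ) :=
  (measurePreserving_snoc n).measurable

theorem measurable_lastSlice {n : ℕ} {u : (Fin (n + 1) → ℝ) → ℝ} (hu : Measurable u) (t : ℝ) :
    Measurable (lastSlice u t) :=
  hu.comp (measurable_snoc.comp measurable_prodMk_left)

theorem measurable_mixedNormE_lastSlice {n : ℕ} (p : ℕ → ℝ) {u : (Fin (n + 1) → ℝ) → ℝ}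
    (hu : Measurable u) : Measurable fun t => mixedNormE n p (lastSlice u t) := by
  simp_rw [mixedNormE, ← mixedAuxE_snoc p u _ le_rfl]
  exact (measurable_mixedAuxE p hu n).comp (measurable_snoc.comp measurable_prodMk_right)

theorem mixedNormE_add_le {n : ℕ} {p : ℕ → ℝ} (hp : ∀ i < n, 1 ≤ p i) {u v : (Fin n → ℝ) → ℝ}
    (hu : Measurable u) (hv : Measurable v) :
    mixedNormE n p (fun x => u x + v x) ≤ mixedNormE n p u + mixedNormE n p v := by
  induction n with
  | zero =>
    simp only [mixedNormE_zero]
    rw [← ENNReal.ofReal_add (abs_nonneg _) (abs_nonneg _)]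
    exact ENNReal.ofReal_le_ofReal (abs_add_le _ _)
  | succ n ih =>
    have hpn := hp n n.lt_succ_self
    simp only [mixedNormE_succ, ← one_div]
    refine le_trans ?_ (ENNReal.lintegral_Lp_add_le
      (measurable_mixedNormE_lastSlice p hu).aemeasurable
      (measurable_mixedNormE_lastSlice p hv).aemeasurable hpn)
    gcongr with t
    exact ih (fun i hi => hp i (by omega)) (measurable_lastSlice hu t) (measurable_lastSlice hv t)

theorem mixedNormE_const_mul {n : ℕ} {p : ℕ → ℝ} (hp : ∀ i < n, 0 < p i) (s : ℝ)
    (v : (Fin n → ℝ) → ℝ) :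
    mixedNormE n p (fun x => s * v x) = ENNReal.ofReal |s| * mixedNormE n p v := by
  induction n with
  | zero => simp only [mixedNormE_zero, abs_mul, ENNReal.ofReal_mul (abs_nonneg _)]
  | succ n ih =>
    have hpn := hp n n.lt_succ_self
    have h (t : ℝ) : mixedNormE n p (lastSlice (fun x => s * v x) t) =
        ENNReal.ofReal |s| * mixedNormE n p (lastSlice v t) :=
      ih (fun i hi => hp i (by omega)) _
    simp only [mixedNormE_succ, h, ENNReal.mul_rpow_of_nonneg _ _ hpn.le]
    rw [lintegral_const_mul' _ _ (ENNReal.rpow_ne_top_of_nonneg hpn.le ENNReal.ofReal_ne_top),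
      ENNReal.mul_rpow_of_nonneg _ _ (inv_nonneg.2 hpn.le), ENNReal.rpow_rpow_inv hpn.ne']

theorem mixedNormE_succ_rpow {n : ℕ} {p : ℕ → ℝ} (hp : p n ≠ 0) (u : (Fin (n + 1) → ℝ) → ℝ) :
    mixedNormE (n + 1) p u ^ p n = ∫⁻ t : ℝ, mixedNormE n p (lastSlice u t) ^ p n := by
  rw [mixedNormE_succ, ENNReal.rpow_inv_rpow hp]

theorem ae_mixedNormE_lastSlice_lt_top {n : ℕ} {p : ℕ → ℝ} (hp : 0 < p n)
    {u : (Fin (n + 1) → ℝ) → ℝ} (hu : Measurable u) (hfin : mixedNormE (n + 1) p u < ⊤) :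
    ∀ᵐ t : ℝ, mixedNormE n p (lastSlice u t) < ⊤ := by
  have h := ae_lt_top ((measurable_mixedNormE_lastSlice p hu).pow_const (p n))
    (by rw [← mixedNormE_succ_rpow hp.ne']; exact ENNReal.rpow_ne_top_of_nonneg hp.le hfin.ne)
  filter_upwards [h] with t ht
  simpa [ENNReal.rpow_lt_top_iff_of_pos hp] using ht

theorem mixedNorm_nonneg (n : ℕ) (p : ℕ → ℝ) (u : (Fin n → ℝ) → ℝ) : 0 ≤ mixedNorm n p u :=
  ENNReal.toReal_nonneg

/-- The gradient of the mixed norm, written so that it is recursive in the dimension (see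
`mixedGrad_snoc`); the product telescopes to that of `Fp` wherever no iterated norm vanishes. -/
def mixedGrad (n : ℕ) (p : ℕ → ℝ) (u : (Fin n → ℝ) → ℝ) (x : Fin n → ℝ) : ℝ :=
  (∏ i : Fin n, (mixedAuxE n p u (i + 1) x).toReal ^ (1 - p i) *
    (mixedAuxE n p u i x).toReal ^ (p i - 1)) * SignType.sign (u x)

theorem mixedGrad_snoc {n : ℕ} (p : ℕ → ℝ) (u : (Fin (n + 1) → ℝ) → ℝ) (t : ℝ)
    (y : Fin n → ℝ) :
    mixedGrad (n + 1) p u (Fin.snoc y t) =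
      mixedNorm (n + 1) p u ^ (1 - p n) * (mixedNorm n p (lastSlice u t) ^ (p n - 1) *
        mixedGrad n p (lastSlice u t) y) := by
  have h (i : Fin n) : (i : ℕ) + 1 ≤ n := i.2
  simp only [mixedGrad, Fin.prod_univ_castSucc, Fin.val_castSucc, Fin.val_last,
    mixedAuxE_snoc p u t (h _), mixedAuxE_snoc p u t (Fin.is_lt _).le, mixedAuxE_snoc p u t le_rfl,
    mixedAuxE_self, mixedNorm]
  simp only [lastSlice]
  ring

theorem measurable_coe_sign : Measurable fun r : ℝ => ((SignType.sign r : SignType) : ℝ) := by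
  have h : (fun r : ℝ => ((SignType.sign r : SignType) : ℝ)) =
      fun r => if 0 < r then 1 else if r < 0 then -1 else 0 := by
    ext r
    rw [sign_apply]
    split_ifs <;> simp
  rw [h]
  exact Measurable.ite measurableSet_Ioi measurable_const
    (Measurable.ite measurableSet_Iio measurable_const measurable_const)

theorem measurable_mixedGrad {n : ℕ} (p : ℕ → ℝ) {u : (Fin n → ℝ) → ℝ} (hu : Measurable u) :
    Measurable (mixedGrad n p u) := by
  refine Measurable.mul (Finset.measurable_prod _ fun i _ => ?_) (measurable_coe_sign.comp hu)
  exact ((measurable_mixedAuxE p hu _).ennreal_toReal.pow_const _).mul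
    ((measurable_mixedAuxE p hu _).ennreal_toReal.pow_const _)

theorem lintegral_snoc {n : ℕ} {f : (Fin (n + 1) → ℝ) → ℝ≥0∞} (hf : Measurable f) :
    ∫⁻ x, f x = ∫⁻ t : ℝ, ∫⁻ y : Fin n → ℝ, f (Fin.snoc y t) := by
  rw [← (measurePreserving_snoc n).lintegral_comp hf, Measure.volume_eq_prod,
    lintegral_prod (fun z : ℝ × (Fin n → ℝ) => f (Fin.snoc z.2 z.1))
      (hf.comp measurable_snoc).aemeasurable]

theorem integral_snoc {n : ℕ} {f : (Fin (n + 1) → ℝ) → ℝ} (hm : Measurable f)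
    (hf : Integrable f) :
    ∫ x, f x = ∫ t : ℝ, ∫ y : Fin n → ℝ, f (Fin.snoc y t) := by
  rw [← (measurePreserving_snoc n).map_eq,
    integral_map measurable_snoc.aemeasurable hm.aestronglyMeasurable, Measure.volume_eq_prod,
    integral_prod]
  exact (measurePreserving_snoc n).integrable_comp_of_integrable hf

theorem ofReal_toReal_rpow_le (a : ℝ≥0∞) {r : ℝ} (hr : 0 ≤ r) :
    ENNReal.ofReal (a.toReal ^ r) ≤ a ^ r := by
  rw [← ENNReal.ofReal_rpow_of_nonneg ENNReal.toReal_nonneg hr]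
  gcongr
  exact ENNReal.ofReal_toReal_le

theorem ofReal_toReal_rpow_neg_mul_rpow_le_one (a : ℝ≥0∞) {r : ℝ} (hr : 0 < r) :
    ENNReal.ofReal (a.toReal ^ (-r)) * a ^ r ≤ 1 := by
  rcases eq_or_ne a 0 with rfl | h0
  · simp [hr]
  rcases eq_or_ne a ⊤ with rfl | htop
  · simp [hr.ne']
  rw [← ENNReal.ofReal_rpow_of_pos (ENNReal.toReal_pos h0 htop), ENNReal.ofReal_toReal htop,
    ← ENNReal.rpow_add _ _ h0 htop]
  simp

theorem lintegral_mixedGrad_mul_le {n : ℕ} {p : ℕ → ℝ} (hp : ∀ i < n, 1 < p i)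
    {u v : (Fin n → ℝ) → ℝ} (hu : Measurable u) (hv : Measurable v) :
    ∫⁻ x, ‖mixedGrad n p u x * v x‖ₑ ≤ mixedNormE n p v := by
  induction n with
  | zero =>
    rw [lintegral_congr (g := fun _ => ‖mixedGrad 0 p u 0 * v 0‖ₑ)
      fun x => by rw [Subsingleton.elim x 0], lintegral_const, mixedNormE_zero]
    have h : ((SignType.sign (u 0) : SignType) : ℝ) = 1 ∨
        ((SignType.sign (u 0) : SignType) : ℝ) = -1 ∨
        ((SignType.sign (u 0) : SignType) : ℝ) = 0 := by
      cases SignType.sign (u 0) <;> simp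
    rcases h with h | h | h <;> simp [mixedGrad, h, Real.enorm_eq_ofReal_abs, volume_pi, -Matrix.zero_empty]
  | succ n ih =>
    have hpn := hp n n.lt_succ_self
    have hconj : (p n / (p n - 1)).HolderConjugate (p n) :=
      (Real.HolderConjugate.conjExponent hpn).symm
    set c : ℝ≥0∞ := ENNReal.ofReal (mixedNorm (n + 1) p u ^ (-(p n - 1))) with hc
    set N : ℝ → ℝ≥0∞ := fun t => mixedNormE n p (lastSlice u t) with hN
    set M : ℝ → ℝ≥0∞ := fun t => mixedNormE n p (lastSlice v t) with hM
    have hNm : Measurable N := measurable_mixedNormE_lastSlice p hu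
    have hMm : Measurable M := measurable_mixedNormE_lastSlice p hv
    have hslice (t : ℝ) : ∫⁻ y, ‖mixedGrad (n + 1) p u (Fin.snoc y t) * v (Fin.snoc y t)‖ₑ ≤
        c * (N t ^ (p n - 1) * M t) := by
      have h1 (y : Fin n → ℝ) :
          ‖mixedGrad (n + 1) p u (Fin.snoc y t) * v (Fin.snoc y t)‖ₑ =
          c * ENNReal.ofReal (mixedNorm n p (lastSlice u t) ^ (p n - 1)) *
            ‖mixedGrad n p (lastSlice u t) y * lastSlice v t y‖ₑ := by
        rw [mixedGrad_snoc, enorm_mul, enorm_mul, enorm_mul, enorm_mul,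
          Real.enorm_of_nonneg (Real.rpow_nonneg (mixedNorm_nonneg _ _ _) _),
          Real.enorm_of_nonneg (Real.rpow_nonneg (mixedNorm_nonneg _ _ _) _), hc, neg_sub, lastSlice]
        ring
      simp_rw [h1]
      rw [lintegral_const_mul' _ _ (by finiteness), mul_assoc]
      gcongr
      · exact ofReal_toReal_rpow_le _ (by linarith)
      · exact ih (fun i hi => hp i (by omega)) (measurable_lastSlice hu t)
          (measurable_lastSlice hv t)
    calc ∫⁻ x, ‖mixedGrad (n + 1) p u x * v x‖ₑ
        = ∫⁻ t, ∫⁻ y, ‖mixedGrad (n + 1) p u (Fin.snoc y t) * v (Fin.snoc y t)‖ₑ :=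
          lintegral_snoc ((measurable_mixedGrad p hu).mul hv).enorm
      _ ≤ ∫⁻ t, c * (N t ^ (p n - 1) * M t) := lintegral_mono hslice
      _ = c * ∫⁻ t, N t ^ (p n - 1) * M t := lintegral_const_mul' _ _ ENNReal.ofReal_ne_top
      _ ≤ c * ((∫⁻ t, (N t ^ (p n - 1)) ^ (p n / (p n - 1))) ^ (1 / (p n / (p n - 1))) *
            (∫⁻ t, M t ^ p n) ^ (1 / p n)) := by
          gcongr
          exact ENNReal.lintegral_mul_le_Lp_mul_Lq volume hconj
            (hNm.pow_const _).aemeasurable hMm.aemeasurable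
      _ = c * mixedNormE (n + 1) p u ^ (p n - 1) * mixedNormE (n + 1) p v := by
          have h1 : (p n - 1) * (p n / (p n - 1)) = p n := by
            field_simp [show p n - 1 ≠ 0 by linarith]
          have h2 : (p n)⁻¹ * (p n - 1) = 1 / (p n / (p n - 1)) := by
            field_simp
          simp_rw [← ENNReal.rpow_mul, h1]
          rw [mixedNormE_succ, mixedNormE_succ, ← ENNReal.rpow_mul, h2, one_div (p n), mul_assoc]
      _ ≤ 1 * mixedNormE (n + 1) p v := by
          gcongr
          exact ofReal_toReal_rpow_neg_mul_rpow_le_one _ (by linarith)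
      _ = mixedNormE (n + 1) p v := one_mul _

theorem abs_rpow_sub_rpow_le {q a b M : ℝ} (hq : 1 ≤ q) (ha : 0 ≤ a) (haM : a ≤ M) (hb : 0 ≤ b)
    (hbM : b ≤ M) : |a ^ q - b ^ q| ≤ q * M ^ (q - 1) * |a - b| := by
  refine Convex.norm_image_sub_le_of_norm_hasDerivWithin_le (s := Set.Icc 0 M)
    (f := fun x => x ^ q) (f' := fun x => q * x ^ (q - 1))
    (fun x _ => (Real.hasDerivAt_rpow_const (Or.inr hq)).hasDerivWithinAt) (fun x hx => ?_)
    (convex_Icc 0 M) ⟨hb, hbM⟩ ⟨ha, haM⟩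
  rw [Real.norm_of_nonneg (mul_nonneg (by linarith) (Real.rpow_nonneg hx.1 _))]
  exact mul_le_mul_of_nonneg_left (Real.rpow_le_rpow hx.1 hx.2 (by linarith)) (by linarith)

theorem hasDerivAt_rpow_of_le_mul_abs {q C : ℝ} {f : ℝ → ℝ} (hq : 1 < q) (hf : ∀ s, 0 ≤ f s)
    (hC : ∀ s, f s ≤ C * |s|) : HasDerivAt (fun s => f s ^ q) 0 0 := by
  have hC0 : 0 ≤ C := by simpa using (hf 1).trans (hC 1)
  have h0 : f 0 = 0 := le_antisymm (by simpa using hC 0) (hf 0)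
  have h := (hasDerivAt_abs_rpow 0 hq)
  rw [hasDerivAt_iff_isLittleO] at h ⊢
  refine Asymptotics.IsBigO.trans_isLittleO (Asymptotics.IsBigO.of_bound (C ^ q) ?_) h
  refine Eventually.of_forall fun s => ?_
  have hq0 : q ≠ 0 := by linarith
  simp only [h0, Real.zero_rpow hq0, smul_zero, sub_zero, mul_zero, abs_zero]
  rw [Real.norm_of_nonneg (Real.rpow_nonneg (hf s) _),
    Real.norm_of_nonneg (Real.rpow_nonneg (abs_nonneg s) _), ← Real.mul_rpow hC0 (abs_nonneg s)]
  exact Real.rpow_le_rpow (hf s) (hC s) (by linarith)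

theorem hasDerivAt_integral_rpow {α : Type*} [MeasurableSpace α] {μ : Measure α} {q : ℝ}
    (hq : 1 < q) {f : ℝ → α → ℝ} {h D : α → ℝ} (hf0 : ∀ s a, 0 ≤ f s a)
    (hfm : ∀ s, Measurable (f s)) (hh0 : ∀ a, 0 ≤ h a) (hDm : Measurable D)
    (hlip : ∀ᵐ a ∂μ, ∀ s s', |f s a - f s' a| ≤ h a * |s - s'|)
    (hf_int : Integrable (fun a => f 0 a ^ q) μ) (hh_int : Integrable (fun a => h a ^ q) μ)
    (hD : ∀ᵐ a ∂μ, f 0 a ≠ 0 → HasDerivAt (fun s => f s a) (D a) 0) :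
    HasDerivAt (fun s => ∫ a, f s a ^ q ∂μ) (q * ∫ a, f 0 a ^ (q - 1) * D a ∂μ) 0 := by
  have hq0 : 0 < q := by linarith
  rw [← integral_const_mul]
  refine (hasDerivAt_integral_of_dominated_loc_of_lip (s := Metric.ball 0 1)
    (F := fun s a => f s a ^ q) (F' := fun a => q * (f 0 a ^ (q - 1) * D a))
    (bound := fun a => q * (2 ^ q * (f 0 a ^ q + h a ^ q))) (Metric.ball_mem_nhds _ one_pos)
    (Eventually.of_forall fun s => ((hfm s).pow_const q).aestronglyMeasurable) hf_int
    ((((hfm 0).pow_const _).mul hDm).const_mul q).aestronglyMeasurable ?_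
    (((hf_int.add hh_int).const_mul _).const_mul _) ?_).2
  · filter_upwards [hlip] with a ha
    have hfa := hf0 0 a
    have hha := hh0 a
    rw [lipschitzOnWith_iff_norm_sub_le]
    intro s hs s' hs'
    have hM (r : ℝ) (hr : r ∈ Metric.ball (0 : ℝ) 1) : f r a ≤ f 0 a + h a := by
      have h1 := (le_abs_self _).trans (ha r 0)
      have h2 : |r| ≤ 1 := by simpa using (Metric.mem_ball.1 hr).le
      rw [sub_zero] at h1
      nlinarith
    have hmul : (f 0 a + h a) ^ (q - 1) * h a ≤ 2 ^ q * (f 0 a ^ q + h a ^ q) := by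
      have h3 : (f 0 a + h a) ^ (q - 1) * h a ≤ (2 * max (f 0 a) (h a)) ^ q := by
        have h5 : (2 * max (f 0 a) (h a)) ^ q =
            (2 * max (f 0 a) (h a)) ^ (q - 1) * (2 * max (f 0 a) (h a)) := by
          rw [← Real.rpow_add_one' (by positivity) (by linarith), sub_add_cancel]
        rw [h5]
        have h6 := le_max_left (f 0 a) (h a)
        have h7 := le_max_right (f 0 a) (h a)
        exact mul_le_mul (Real.rpow_le_rpow (by positivity) (by linarith) (by linarith))
          (by linarith) hha (by positivity)
      refine h3.trans ?_
      rw [Real.mul_rpow (by norm_num) (by positivity)]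
      gcongr
      rcases max_choice (f 0 a) (h a) with h4 | h4 <;> rw [h4]
      · exact le_add_of_nonneg_right (by positivity)
      · exact le_add_of_nonneg_left (by positivity)
    rw [Real.coe_nnabs, abs_of_nonneg (by positivity)]
    calc ‖f s a ^ q - f s' a ^ q‖ ≤ q * (f 0 a + h a) ^ (q - 1) * |f s a - f s' a| :=
          abs_rpow_sub_rpow_le hq.le (hf0 s a) (hM s hs) (hf0 s' a) (hM s' hs')
      _ ≤ q * (f 0 a + h a) ^ (q - 1) * (h a * |s - s'|) := by gcongr; exact ha s s'
      _ = q * ((f 0 a + h a) ^ (q - 1) * h a) * ‖s - s'‖ := by rw [Real.norm_eq_abs]; ring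
      _ ≤ _ := by gcongr
  · filter_upwards [hlip, hD] with a ha hDa
    by_cases h0 : f 0 a = 0
    · rw [h0, Real.zero_rpow (by linarith), zero_mul, mul_zero]
      refine hasDerivAt_rpow_of_le_mul_abs hq (fun s => hf0 s a) (C := h a) fun s => ?_
      simpa [h0] using (le_abs_self _).trans (ha s 0)
    · exact ((hDa h0).rpow_const (p := q) (Or.inl h0)).congr_deriv (by ring)

theorem measurable_uncurry_mixedGrad_lastSlice {n : ℕ} (p : ℕ → ℝ)
    {u : (Fin (n + 1) → ℝ) → ℝ} (hu : Measurable u) :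
    Measurable fun z : ℝ × (Fin n → ℝ) => mixedGrad n p (lastSlice u z.1) z.2 := by
  have h (i : Fin n) : (i : ℕ) + 1 ≤ n := i.2
  simp only [mixedGrad, ← mixedAuxE_snoc p u _ (h _), ← mixedAuxE_snoc p u _ (Fin.is_lt _).le]
  have hm (j : ℕ) := ((measurable_mixedAuxE p hu j).comp measurable_snoc).ennreal_toReal
  exact (Finset.measurable_prod _ fun i _ => ((hm _).pow_const _).mul ((hm _).pow_const _)).mul
    (measurable_coe_sign.comp (hu.comp measurable_snoc))

theorem mixedNormE_add_mul_lt_top {n : ℕ} {p : ℕ → ℝ} (hp : ∀ i < n, 1 < p i)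
    {u v : (Fin n → ℝ) → ℝ} (hu : Measurable u) (hv : Measurable v)
    (hu' : mixedNormE n p u < ⊤) (hv' : mixedNormE n p v < ⊤) (s : ℝ) :
    mixedNormE n p (fun x => u x + s * v x) < ⊤ := by
  refine (mixedNormE_add_le (fun i hi => (hp i hi).le) hu (hv.const_mul s)).trans_lt ?_
  rw [mixedNormE_const_mul (fun i hi => by linarith [hp i hi])]
  finiteness

theorem abs_mixedNorm_add_mul_sub_le {n : ℕ} {p : ℕ → ℝ} (hp : ∀ i < n, 1 < p i)
    {u v : (Fin n → ℝ) → ℝ} (hu : Measurable u) (hv : Measurable v)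
    (hu' : mixedNormE n p u < ⊤) (hv' : mixedNormE n p v < ⊤) (s s' : ℝ) :
    |mixedNorm n p (fun x => u x + s * v x) - mixedNorm n p (fun x => u x + s' * v x)| ≤
      mixedNorm n p v * |s - s'| := by
  have key (s s' : ℝ) : mixedNorm n p (fun x => u x + s * v x) ≤
      mixedNorm n p (fun x => u x + s' * v x) + mixedNorm n p v * |s - s'| := by
    have h1 := mixedNormE_add_le (p := p) (fun i hi => (hp i hi).le)
      (hu.add (hv.const_mul s')) (hv.const_mul (s - s'))
    rw [mixedNormE_const_mul (fun i hi => by linarith [hp i hi])] at h1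
    have h2 : (fun x => u x + s * v x) =
        fun x => (u + fun x => s' * v x) x + (s - s') * v x := by
      ext x
      simp only [Pi.add_apply]
      ring
    have h3 := (mixedNormE_add_mul_lt_top hp hu hv hu' hv' s').ne
    rw [h2, mixedNorm]
    refine (ENNReal.toReal_mono (ENNReal.add_ne_top.2 ⟨h3, by finiteness⟩) h1).trans ?_
    rw [ENNReal.toReal_add h3 (by finiteness), ENNReal.toReal_mul,
      ENNReal.toReal_ofReal (abs_nonneg _), mul_comm |s - s'|]
    rfl
  rw [abs_sub_le_iff]
  constructor
  · linarith [key s s']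
  · have := key s' s
    rw [abs_sub_comm s'] at this
    linarith

theorem integrable_mixedNorm_lastSlice_rpow {n : ℕ} {p : ℕ → ℝ} (hp : 0 < p n)
    {u : (Fin (n + 1) → ℝ) → ℝ} (hu : Measurable u) (hfin : mixedNormE (n + 1) p u < ⊤) :
    Integrable fun t => mixedNorm n p (lastSlice u t) ^ p n := by
  simp_rw [mixedNorm, ENNReal.toReal_rpow]
  refine integrable_toReal_of_lintegral_ne_top
    ((measurable_mixedNormE_lastSlice p hu).pow_const _).aemeasurable ?_
  rw [← mixedNormE_succ_rpow hp.ne']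
  exact ENNReal.rpow_ne_top_of_nonneg hp.le hfin.ne

theorem integral_mixedNorm_lastSlice_rpow {n : ℕ} {p : ℕ → ℝ} (hp : 0 < p n)
    {u : (Fin (n + 1) → ℝ) → ℝ} (hu : Measurable u) (hfin : mixedNormE (n + 1) p u < ⊤) :
    ∫ t, mixedNorm n p (lastSlice u t) ^ p n = mixedNorm (n + 1) p u ^ p n := by
  simp_rw [mixedNorm, ENNReal.toReal_rpow]
  rw [integral_toReal ((measurable_mixedNormE_lastSlice p hu).pow_const _).aemeasurable,
    mixedNormE_succ_rpow hp.ne']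
  filter_upwards [ae_mixedNormE_lastSlice_lt_top hp hu hfin] with t ht
  exact ENNReal.rpow_lt_top_of_nonneg hp.le ht.ne

theorem integrable_mixedGrad_mul {n : ℕ} {p : ℕ → ℝ} (hp : ∀ i < n, 1 < p i)
    {u v : (Fin n → ℝ) → ℝ} (hu : Measurable u) (hv : Measurable v)
    (hv' : mixedNormE n p v < ⊤) : Integrable fun x => mixedGrad n p u x * v x :=
  ⟨((measurable_mixedGrad p hu).mul hv).aestronglyMeasurable,
    (lintegral_mixedGrad_mul_le hp hu hv).trans_lt hv'⟩

theorem hasDerivAt_mixedNorm {n : ℕ} {p : ℕ → ℝ} (hp : ∀ i < n, 1 < p i)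
    {u v : (Fin n → ℝ) → ℝ} (hu : Measurable u) (hv : Measurable v)
    (hu' : mixedNormE n p u < ⊤) (hv' : mixedNormE n p v < ⊤) (hu0 : mixedNormE n p u ≠ 0) :
    HasDerivAt (fun s => mixedNorm n p (fun x => u x + s * v x))
      (∫ x, mixedGrad n p u x * v x) 0 := by
  induction n with
  | zero =>
    have h0 : u 0 ≠ 0 := by simpa [mixedNormE_zero] using hu0
    have h1 : HasDerivAt (fun s => u 0 + s * v 0) (v 0) 0 := by
      simpa using ((hasDerivAt_id (0 : ℝ)).mul_const (v 0)).const_add (u 0)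
    have h2 : HasDerivAt (|·|) ((SignType.sign (u 0) : SignType) : ℝ) (u 0 + 0 * v 0) := by
      simpa using hasDerivAt_abs h0
    have h3 : ∫ x, mixedGrad 0 p u x * v x = (SignType.sign (u 0) : SignType) * v 0 := by
      rw [integral_congr_ae (g := fun _ => mixedGrad 0 p u 0 * v 0)
        (Eventually.of_forall fun x => by simp only [Subsingleton.elim x 0]), integral_const]
      simp [Measure.real, volume_pi, mixedGrad]
    rw [h3]
    simpa [mixedNorm, mixedNormE_zero, Function.comp_def] using h2.comp 0 h1
  | succ n ih =>
    have hpn := hp n n.lt_succ_self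
    have hpn0 : 0 < p n := by linarith
    have hp' : ∀ i < n, 1 < p i := fun i hi => hp i (by omega)
    have hfin := mixedNormE_add_mul_lt_top hp hu hv hu' hv'
    have hm (s : ℝ) : Measurable fun x => u x + s * v x := hu.add (hv.const_mul s)
    have hz (t : ℝ) : mixedNorm n p (lastSlice (fun x => u x + 0 * v x) t) =
        mixedNorm n p (lastSlice u t) := by simp
    have key := hasDerivAt_integral_rpow (μ := volume) hpn
      (f := fun s t => mixedNorm n p (lastSlice (fun x => u x + s * v x) t))
      (h := fun t => mixedNorm n p (lastSlice v t))
      (D := fun t => ∫ y, mixedGrad n p (lastSlice u t) y * lastSlice v t y)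
      (fun s t => mixedNorm_nonneg _ _ _)
      (fun s => (measurable_mixedNormE_lastSlice p (hm s)).ennreal_toReal)
      (fun t => mixedNorm_nonneg _ _ _)
      (((measurable_uncurry_mixedGrad_lastSlice p hu).mul
        (hv.comp measurable_snoc)).stronglyMeasurable.integral_prod_right').measurable
      (by
        filter_upwards [ae_mixedNormE_lastSlice_lt_top hpn0 hu hu',
          ae_mixedNormE_lastSlice_lt_top hpn0 hv hv'] with t hut hvt s s'
        exact abs_mixedNorm_add_mul_sub_le hp' (measurable_lastSlice hu t)
          (measurable_lastSlice hv t) hut hvt s s')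
      (integrable_mixedNorm_lastSlice_rpow hpn0 (hm 0) (hfin 0))
      (integrable_mixedNorm_lastSlice_rpow hpn0 hv hv')
      (by
        filter_upwards [ae_mixedNormE_lastSlice_lt_top hpn0 hu hu',
          ae_mixedNormE_lastSlice_lt_top hpn0 hv hv'] with t hut hvt ht
        refine ih hp' (measurable_lastSlice hu t) (measurable_lastSlice hv t) hut hvt fun h => ht ?_
        rw [hz]
        exact congrArg ENNReal.toReal h)
    simp only [hz] at key
    have hN : 0 < mixedNorm (n + 1) p u := ENNReal.toReal_pos hu0 hu'.ne
    have hI := integral_mixedNorm_lastSlice_rpow hpn0 hu hu'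
    have hI0 : ∫ t, mixedNorm n p (lastSlice (fun x => u x + 0 * v x) t) ^ p n ≠ 0 := by
      simp only [hz, hI]
      positivity
    refine ((key.rpow_const (p := (p n)⁻¹) (Or.inl hI0)).congr_of_eventuallyEq
      (Eventually.of_forall fun s => ?_)).congr_deriv ?_
    · simp only [integral_mixedNorm_lastSlice_rpow hpn0 (hm s) (hfin s)]
      rw [Real.rpow_rpow_inv (mixedNorm_nonneg _ _ _) hpn0.ne']
    · have hslice (t : ℝ) : ∫ y : Fin n → ℝ,
          mixedGrad (n + 1) p u (Fin.snoc y t) * v (Fin.snoc y t) =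
          mixedNorm (n + 1) p u ^ (1 - p n) * (mixedNorm n p (lastSlice u t) ^ (p n - 1) *
            ∫ y, mixedGrad n p (lastSlice u t) y * lastSlice v t y) := by
        rw [← integral_const_mul, ← integral_const_mul]
        congr 1 with y
        rw [mixedGrad_snoc, lastSlice]
        ring
      rw [integral_snoc (f := fun x => mixedGrad (n + 1) p u x * v x) ((measurable_mixedGrad p hu).mul hv)
        (integrable_mixedGrad_mul hp hu hv hv')]
      simp_rw [hslice, hz, hI]
      rw [integral_const_mul, ← Real.rpow_mul hN.le,
        show p n * ((p n)⁻¹ - 1) = 1 - p n by field_simp]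
      field_simp

theorem ae_snoc {n : ℕ} {P : (Fin (n + 1) → ℝ) → Prop} (hP : MeasurableSet {x | P x})
    (h : ∀ᵐ t : ℝ, ∀ᵐ y : Fin n → ℝ, P (Fin.snoc y t)) : ∀ᵐ x, P x := by
  rw [← (measurePreserving_snoc n).map_eq, ae_map_iff measurable_snoc.aemeasurable hP,
    Measure.volume_eq_prod, Measure.ae_prod_iff_ae_ae (p := fun z : ℝ × (Fin n → ℝ) => P (Fin.snoc z.2 z.1))
      (measurable_snoc hP)]
  exact h

theorem ae_mixedAuxE_pos {n : ℕ} {p : ℕ → ℝ} (hp : ∀ i < n, 0 < p i) {u : (Fin n → ℝ) → ℝ}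
    (hu : Measurable u) (hu' : mixedNormE n p u < ⊤) :
    ∀ᵐ x, u x ≠ 0 → ∀ j ≤ n, 0 < (mixedAuxE n p u j x).toReal := by
  induction n with
  | zero =>
    refine Eventually.of_forall fun x hx j hj => ?_
    rw [Nat.le_zero.1 hj]
    simpa [mixedAuxE] using hx
  | succ n ih =>
    have hpn := hp n n.lt_succ_self
    refine ae_snoc ?_ ?_
    · refine MeasurableSet.imp (measurableSet_eq_fun hu measurable_const).compl ?_
      simp only [Set.ofPred_forall]
      refine MeasurableSet.iInter fun j => MeasurableSet.iInter fun _ => ?_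
      exact measurableSet_lt measurable_const (measurable_mixedAuxE p hu j).ennreal_toReal
    have hpos : mixedNormE (n + 1) p u = 0 → ∀ᵐ t : ℝ, mixedNormE n p (lastSlice u t) = 0 := by
      intro h
      have h1 := mixedNormE_succ_rpow hpn.ne' u
      rw [h, ENNReal.zero_rpow_of_pos hpn, eq_comm, lintegral_eq_zero_iff
        ((measurable_mixedNormE_lastSlice p hu).pow_const _)] at h1
      filter_upwards [h1] with t ht
      simpa [hpn, hpn.le, hpn.not_gt] using ht
    have hall : ∀ᵐ t : ℝ, mixedNormE (n + 1) p u = 0 → mixedNormE n p (lastSlice u t) = 0 := by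
      by_cases h : mixedNormE (n + 1) p u = 0
      · simpa [h] using hpos h
      · simp [h]
    filter_upwards [hall, ae_mixedNormE_lastSlice_lt_top hpn hu hu'] with t ht htfin
    filter_upwards [ih (fun i hi => hp i (by omega)) (measurable_lastSlice hu t) htfin]
      with y hy huy j hj
    have hy := hy huy
    rcases hj.lt_or_eq with hj | rfl
    · rw [mixedAuxE_snoc p u t (by omega)]
      exact hy j (by omega)
    · rw [mixedAuxE_self]
      refine ENNReal.toReal_pos (fun h => ?_) hu'.ne
      have := hy n le_rfl
      simp [mixedAuxE_self, ht h] at this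

theorem mixedGrad_eq_Fp {n : ℕ} (hn : 0 < n) {p : ℕ → ℝ} {u : (Fin n → ℝ) → ℝ}
    {x : Fin n → ℝ} (h : u x ≠ 0 → ∀ j ≤ n, 0 < (mixedAuxE n p u j x).toReal) :
    mixedGrad n p u x = Fp n p u x := by
  by_cases hx : u x = 0
  · simp [mixedGrad, Fp, hx]
  obtain ⟨n, rfl⟩ : ∃ m, n = m + 1 := ⟨n - 1, by omega⟩
  specialize h hx
  set a : ℕ → ℝ := fun j => (mixedAuxE (n + 1) p u j x).toReal with ha
  have ha0 : a 0 = |u x| := by simp [ha, mixedAuxE]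
  have hL : mixedGrad (n + 1) p u x =
      (∏ i : Fin (n + 1), a (i + 1) ^ (1 - p i) * a i ^ (p i - 1)) * SignType.sign (u x) := rfl
  have hR : Fp (n + 1) p u x =
      (∏ i : Fin (n + 1), a (i + 1) ^ ((if (i : ℕ) + 1 < n + 1 then p (i + 1) else 1) - p i)) *
        |u x| ^ (p 0 - 2) * u x := rfl
  rw [hL, hR, Finset.prod_mul_distrib, Fin.prod_univ_castSucc, Fin.prod_univ_succ,
    Fin.prod_univ_castSucc (n := n)]
  have h1 : (∏ i : Fin n, a ((i.castSucc : Fin (n + 1)) + 1) ^ (1 - p (i.castSucc : Fin (n + 1)))) *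
      (∏ i : Fin n, a (i.succ : Fin (n + 1)) ^ (p (i.succ : Fin (n + 1)) - 1)) =
      ∏ i : Fin n, a ((i.castSucc : Fin (n + 1)) + 1) ^
        ((if ((i.castSucc : Fin (n + 1)) : ℕ) + 1 < n + 1 then
          p ((i.castSucc : Fin (n + 1)) + 1) else 1) - p (i.castSucc : Fin (n + 1))) := by
    rw [← Finset.prod_mul_distrib]
    refine Finset.prod_congr rfl fun i _ => ?_
    simp only [Fin.val_castSucc, Fin.val_succ, add_lt_add_iff_right, i.2, if_true]
    rw [← Real.rpow_add (h _ (by omega))]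
    congr 1
    ring
  have h2 : a 0 ^ (p 0 - 1) * SignType.sign (u x) = |u x| ^ (p 0 - 2) * u x := by
    rw [ha0, show p 0 - 1 = (p 0 - 2) + 1 by ring, Real.rpow_add_one (abs_ne_zero.2 hx), mul_assoc,
      mul_comm |u x|, sign_mul_abs]
  rw [← h1, mul_assoc _ (|u x| ^ (p 0 - 2)), ← h2]
  simp only [Fin.val_last, Fin.val_zero, lt_irrefl, if_false]
  ring

theorem ae_ae_update {n : ℕ} (i : Fin n) {P : (Fin n → ℝ) → Prop} (h : ∀ᵐ x, P x) :
    ∀ᵐ x, ∀ᵐ t : ℝ, P (Function.update x i t) := by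
  obtain ⟨n, rfl⟩ : ∃ m, n = m + 1 := ⟨n - 1, by have := i.2; omega⟩
  have he := volume_preserving_piFinSuccAbove (fun _ : Fin (n + 1) => ℝ) i
  have h1 := he.symm.quasiMeasurePreserving.ae h
  have h2 : ∀ᵐ z : (Fin n → ℝ) × ℝ, P (Fin.insertNth (α := fun _ => ℝ) i z.2 z.1) :=
    (Measure.measurePreserving_swap (μ := (volume : Measure (Fin n → ℝ)))
      (ν := (volume : Measure ℝ))).quasiMeasurePreserving.ae h1
  have h3 := Measure.ae_ae_of_ae_prod h2
  have h4 := (Measure.quasiMeasurePreserving_snd.comp he.quasiMeasurePreserving).ae h3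
  filter_upwards [h4] with x hx
  filter_upwards [hx] with t ht
  convert ht using 1
  simp [Fin.insertNth_removeNth]

theorem ae_mixedAuxE_congr {n : ℕ} (p : ℕ → ℝ) {u w : (Fin n → ℝ) → ℝ} (h : u =ᵐ[volume] w)
    {j : ℕ} (hj : j ≤ n) : mixedAuxE n p u j =ᵐ[volume] mixedAuxE n p w j := by
  induction j with
  | zero =>
    filter_upwards [h] with x hx
    simp [mixedAuxE, hx]
  | succ j ih =>
    have hj' : j < n := hj
    filter_upwards [ae_ae_update ⟨j, hj'⟩ (ih hj'.le)] with x hx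
    simp only [mixedAuxE, hj', dif_pos]
    congr 1
    refine lintegral_congr_ae ?_
    filter_upwards [hx] with t ht
    rw [ht]

theorem mixedNormE_congr {n : ℕ} (p : ℕ → ℝ) {u w : (Fin n → ℝ) → ℝ} (h : u =ᵐ[volume] w) :
    mixedNormE n p u = mixedNormE n p w := by
  obtain ⟨x, hx⟩ := (ae_mixedAuxE_congr p h le_rfl).exists
  rwa [mixedAuxE_self, mixedAuxE_self] at hx

theorem Fp_congr {n : ℕ} (p : ℕ → ℝ) {u w : (Fin n → ℝ) → ℝ} (h : u =ᵐ[volume] w) :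
    Fp n p u =ᵐ[volume] Fp n p w := by
  have h1 : ∀ᵐ x, ∀ i : Fin n, mixedAuxE n p u (i + 1) x = mixedAuxE n p w (i + 1) x :=
    ae_all_iff.2 fun i => ae_mixedAuxE_congr p h i.2
  filter_upwards [h, h1] with x hx hx'
  simp only [Fp, hx, hx']

/-- Gateaux differentiability of `I(u) = ‖u‖_𝐩` with `I' = 𝓕_𝐩`. -/
theorem stmt7_I_gateaux
    (n : ℕ) (hn : 0 < n) (p : ℕ → ℝ)
    (hp : ∀ i, i < n → 1 < p i)
    (hpmono : ∀ i j, i ≤ j → j < n → p i ≤ p j)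
    (Ω : Set (Fin n → ℝ)) (hΩopen : IsOpen Ω) (hΩbdd : Bornology.IsBounded Ω)
    (u v : (Fin n → ℝ) → ℝ)
    (hu : MemMixedLpOn n p Ω u) (hv : MemMixedLpOn n p Ω v)
    (hune : mixedNormE n p u ≠ 0) :
    HasDerivAt (fun t : ℝ => mixedNorm n p (fun x => u x + t * v x))
      (∫ x : Fin n → ℝ, Fp n p u x * v x) 0 := by
  obtain ⟨hum, hu'⟩ := hu.1
  obtain ⟨hvm, hv'⟩ := hv.1
  have hU := hum.ae_eq_mk
  have hV := hvm.ae_eq_mk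
  rw [mixedNormE_congr p hU] at hu' hune
  rw [mixedNormE_congr p hV] at hv'
  refine ((hasDerivAt_mixedNorm hp hum.measurable_mk hvm.measurable_mk hu' hv'
    hune).congr_of_eventuallyEq (Eventually.of_forall fun s => ?_)).congr_deriv ?_
  · refine congrArg ENNReal.toReal (mixedNormE_congr p ?_)
    filter_upwards [hU, hV] with x hx hx'
    rw [hx, hx']
  · refine integral_congr_ae ?_
    filter_upwards [hV, Fp_congr p hU, ae_mixedAuxE_pos (fun i hi => by linarith [hp i hi])
      hum.measurable_mk hu'] with x hx hF hpos
    rw [hx, hF, mixedGrad_eq_Fp hn hpos]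

end
end
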